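/- arXiv:1306.0758 — 2 statements merged into one kernel-verified Lean document; each statement's English description precedes it below -/
import Mathlib

section
/- Let n and k be positive integers with n ≥ 2k ≥ 38 and suppose (n,k) does not belong to the set T. Then there are at least five distinct indices i with 0 ≤ i ≤ k−1 such that n−i is divisible by a prime exceeding k; that is, at least five distinct terms of the product n(n−1)⋯(n−k+1) each have a prime factor greater than k. -/
/-- The exceptional set `T` of pairs `(n, k)` from Laishram–Shorey, given as the union of the
sets `[n, k, h] = {(n, k), (n+1, k), …, (n+h−1, k)}` listed in the paper. -/
def T : Set (ℕ × ℕ) :=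
  {(38, 19), (39, 19), (40, 19), (42, 19), (40, 20), (94, 47), (95, 47), (96, 47), (100, 47),
    (96, 48), (144, 71), (145, 71), (145, 72), (146, 73), (147, 73), (148, 73), (156, 73),
    (148, 74), (162, 79), (166, 83), (172, 83), (190, 83), (192, 83), (178, 89), (190, 89),
    (192, 89), (210, 103), (211, 103), (212, 103), (213, 103), (216, 103), (217, 103), (213,
    104), (217, 104), (214, 107), (215, 107), (216, 107), (217, 107), (218, 107), (219, 107),
    (220, 107), (221, 107), (222, 107), (223, 107), (224, 107), (225, 107), (216, 108), (217,
    108), (218, 108), (219, 108), (220, 108), (221, 108), (222, 108), (223, 108), (224, 108),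
    (225, 108), (218, 109), (219, 109), (220, 109), (221, 109), (222, 109), (223, 109), (224,
    109), (225, 109), (226, 109), (220, 110), (221, 110), (222, 110), (223, 110), (224, 110),
    (225, 110), (226, 110), (222, 111), (223, 111), (224, 111), (225, 111), (226, 111), (224,
    112), (225, 112), (226, 112), (226, 113), (227, 113), (228, 113), (229, 113), (230, 113),
    (231, 113), (232, 113), (250, 113), (252, 113), (253, 113), (228, 114), (229, 114), (230,
    114), (231, 114), (232, 114), (253, 114), (230, 115), (231, 115), (232, 115), (232, 116),
    (346, 173), (378, 181), (380, 181), (381, 181), (381, 182), (392, 193), (393, 193), (393,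
    194), (396, 197), (398, 199), (399, 199), (400, 199), (400, 200), (552, 271), (553, 271),
    (554, 271), (555, 271), (556, 271), (553, 272), (555, 272), (556, 272), (556, 273), (554,
    277), (555, 277), (556, 277), (558, 277), (559, 277), (560, 277), (561, 277), (562, 277),
    (556, 278), (559, 278), (560, 278), (561, 278), (562, 278), (560, 279), (561, 279), (562,
    279), (561, 280), (562, 281), (563, 281), (564, 281), (565, 281), (566, 281), (567, 281),
    (568, 281), (564, 282), (565, 282), (566, 282), (567, 282), (568, 282), (566, 283), (567,
    283), (568, 283), (569, 283), (570, 283), (576, 283), (568, 284), (569, 284), (570, 284),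
    (570, 285), (586, 293)}


/-- The conclusion of the theorem. -/
def FiveTerms (n k : ℕ) : Prop :=
  ∃ I : Finset ℕ, I.card = 5 ∧ ∀ i ∈ I, i ≤ k - 1 ∧
      ∃ p : ℕ, p.Prime ∧ k < p ∧ p ∣ (n - i)

lemma core_bound {n k : ℕ} (hk : 1 ≤ k) (hkn : k ≤ n) (h : ¬ FiveTerms n k) :
    n.choose k ≤ n ^ 4 * ∏ p ∈ Nat.primesLE k, p ^ ((n.choose k).factorization p) := by
  classical
  set C := n.choose k with hC
  let S := (Finset.range k).filter (fun i => ∃ p : ℕ, p.Prime ∧ k < p ∧ p ∣ (n - i))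
  have hS : S.card ≤ 4 := by
    by_contra hcon
    obtain ⟨I, hI, hc⟩ := Finset.exists_subset_card_eq (show 5 ≤ S.card by omega)
    refine h ⟨I, hc, fun i hi => ?_⟩
    have := Finset.mem_filter.mp (hI hi)
    exact ⟨by have := Finset.mem_range.mp this.1; omega, this.2⟩
  have hA : ∏ i ∈ S, (n - i) ≤ n ^ 4 := by
    calc ∏ i ∈ S, (n - i) ≤ n ^ S.card := Finset.prod_le_pow_card _ _ _ (fun i _ => Nat.sub_le _ _)
      _ ≤ n ^ 4 := Nat.pow_le_pow_right (by omega) hS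
  have hApos : 0 < ∏ i ∈ S, (n - i) := Finset.prod_pos (fun i hi => by
    have := Finset.mem_range.mp (Finset.mem_filter.mp hi).1; omega)
  have hdesc : C ∣ (∏ i ∈ S, (n - i)) *
      ∏ i ∈ (Finset.range k).filter (fun i => ¬ ∃ p : ℕ, p.Prime ∧ k < p ∧ p ∣ (n - i)), (n - i) := by
    rw [Finset.prod_filter_mul_prod_filter_not, ← Nat.descFactorial_eq_prod_range,
      Nat.descFactorial_eq_factorial_mul_choose]
    exact Dvd.intro_left _ rfl
  have hbig : ∏ p ∈ (Finset.range (n+1)).filter (fun p => p.Prime ∧ k < p), p ^ C.factorization p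
      ∣ ∏ i ∈ S, (n - i) := by
    apply Finset.prod_dvd_of_isRelPrime
    · intro p hp q hq hpq
      simp only [Finset.coe_filter, Set.mem_ofPred_eq] at hp hq
      simp only [Function.onFun]
      rw [← Nat.coprime_iff_isRelPrime]
      exact Nat.Coprime.pow _ _ ((Nat.coprime_primes hp.2.1 hq.2.1).mpr hpq)
    · intro p hp
      obtain ⟨_, hpp, hkp⟩ := Finset.mem_filter.mp hp
      have h1 := (Nat.ordProj_dvd C p).trans hdesc
      refine Nat.Coprime.dvd_of_dvd_mul_right ?_ h1
      apply Nat.Coprime.pow_left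
      apply Nat.Coprime.prod_right
      intro i hi
      rw [hpp.coprime_iff_not_dvd]
      intro hd
      exact (Finset.mem_filter.mp hi).2 ⟨p, hpp, hkp, hd⟩
  have hsplit : C = (∏ p ∈ (Finset.range (n+1)).filter (fun p => p.Prime ∧ k < p), p ^ C.factorization p) *
      ∏ p ∈ Nat.primesLE k, p ^ (C.factorization p) := by
    conv_lhs => rw [hC, ← Nat.prod_pow_factorization_choose n k hkn]
    rw [← Finset.prod_union]
    · symm
      apply Finset.prod_subset
      · intro p hp
        simp only [Finset.mem_union, Finset.mem_filter, Nat.mem_primesLE, Finset.mem_range] at hp ⊢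
        omega
      · intro p hp hp'
        simp only [Finset.mem_union, Finset.mem_filter, Nat.mem_primesLE, Finset.mem_range] at hp hp'
        have : ¬ p.Prime := by
          intro hpp
          by_cases hh : k < p <;> simp_all
        rw [Nat.factorization_eq_zero_of_not_prime _ this, pow_zero]
    · rw [Finset.disjoint_left]
      intro p hp hp'
      simp only [Finset.mem_filter, Nat.mem_primesLE] at hp hp'
      omega
  calc C = _ := hsplit
    _ ≤ _ := Nat.mul_le_mul_right _ ((Nat.le_of_dvd hApos hbig).trans hA)

lemma upper_one {n k : ℕ} (hk : 1 ≤ k) (hkn : k ≤ n) (h : ¬ FiveTerms n k) :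
    n.choose k ≤ n ^ (4 + Nat.primeCounting k) := by
  refine (core_bound hk hkn h).trans ?_
  rw [pow_add]
  apply Nat.mul_le_mul_left
  rw [← Nat.primesLE_card_eq_primeCounting]
  exact Finset.prod_le_pow_card _ _ _ (fun p _ => Nat.pow_factorization_choose_le (by omega))

lemma upper_two {n k m : ℕ} (hk : 1 ≤ k) (hkn : k ≤ n) (h : ¬ FiveTerms n k)
    (hm : ∀ p : ℕ, p.Prime → p ≤ k → m < p → (n.choose k).factorization p = 0) :
    n.choose k ≤ n ^ (4 + Nat.primeCounting (Nat.sqrt n)) * 4 ^ m := by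
  classical
  refine (core_bound hk hkn h).trans ?_
  rw [pow_add, mul_assoc]
  apply Nat.mul_le_mul_left
  have h1 : ∀ p ∈ Nat.primesLE k, p ^ ((n.choose k).factorization p) ≤
      (if p ≤ Nat.sqrt n then n else 1) * (if p ≤ m then p else 1) := by
    intro p hp
    obtain ⟨hpk, hpp⟩ := Nat.mem_primesLE.mp hp
    have hp1 := hpp.one_lt
    by_cases hs : p ≤ Nat.sqrt n
    · rw [if_pos hs]
      refine (Nat.pow_factorization_choose_le (by omega)).trans ?_
      split_ifs
      · exact Nat.le_mul_of_pos_right _ (by omega)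
      · omega
    · rw [if_neg hs, one_mul]
      split_ifs with hpm
      · have : (n.choose k).factorization p ≤ 1 :=
          Nat.factorization_choose_le_one (by rw [pow_two]; exact Nat.sqrt_lt.mp (by omega))
        calc _ ≤ p ^ 1 := Nat.pow_le_pow_right (by omega) this
          _ = p := pow_one p
      · rw [hm p hpp hpk (by omega), pow_zero]
  refine (Finset.prod_le_prod' h1).trans ?_
  rw [Finset.prod_mul_distrib]
  apply Nat.mul_le_mul
  · rw [← Finset.prod_filter, Finset.prod_const, ← Nat.primesLE_card_eq_primeCounting]
    apply Nat.pow_le_pow_right (by omega)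
    apply Finset.card_le_card
    intro p hp
    simp only [Finset.mem_filter, Nat.mem_primesLE] at hp ⊢
    tauto
  · rw [← Finset.prod_filter]
    refine le_trans ?_ (primorial_le_four_pow m)
    rw [primorial_eq_prod_primesLE]
    apply Finset.prod_le_prod_of_subset_of_one_le'
    · intro p hp
      simp only [Finset.mem_filter, Nat.mem_primesLE] at hp ⊢
      tauto
    · intro p hp _
      exact (Nat.prime_of_mem_primesLE hp).one_lt.le

lemma pi_bound (s : ℕ) : 15 * Nat.primeCounting s ≤ 4 * s + 150 := by
  have h30 : Nat.primeCounting 30 = 10 := by decide +kernel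
  have hphi : Nat.totient 30 = 8 := by decide +kernel
  by_cases hs : s ≤ 30
  · have := Nat.monotone_primeCounting hs
    omega
  · have := Nat.primeCounting_add_le (a := 30) (k := 30) (by norm_num) le_rfl (s - 30)
    rw [h30, hphi, show 30 + (s - 30) = s by omega] at this
    omega

lemma pow_le_choose' {n k : ℕ} (hkn : k ≤ n) : n ^ k ≤ k ^ k * n.choose k := by
  have h1 : n ^ k * k.factorial ≤ k ^ k * n.descFactorial k := by
    rw [← Nat.descFactorial_self k, Nat.descFactorial_eq_prod_range, Nat.descFactorial_eq_prod_range,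
      Finset.pow_eq_prod_const, Finset.pow_eq_prod_const, ← Finset.prod_mul_distrib,
      ← Finset.prod_mul_distrib]
    apply Finset.prod_le_prod'
    intro i hi
    have := Finset.mem_range.mp hi
    rw [Nat.mul_sub, Nat.mul_sub, mul_comm n k]
    have := Nat.mul_le_mul_right i hkn
    omega
  rw [Nat.descFactorial_eq_factorial_mul_choose] at h1
  have := k.factorial_pos
  nlinarith

/-- Case `n ≥ k ^ (3/2)`. -/
lemma case_iv {n k : ℕ} (hk : 1000 ≤ k) (hkn : k ≤ n) (h : k ^ 3 ≤ n ^ 2) : FiveTerms n k := by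
  by_contra hcon
  have h1 := upper_one (by omega) hkn hcon
  have h2 := pow_le_choose' hkn
  have h3 : n ^ k ≤ k ^ k * n ^ (4 + Nat.primeCounting k) := h2.trans (Nat.mul_le_mul_left _ h1)
  have h4 : n ^ (3 * k) ≤ n ^ (2 * k + 3 * (4 + Nat.primeCounting k)) := by
    calc n ^ (3 * k) = (n ^ k) ^ 3 := by rw [← pow_mul, mul_comm]
      _ ≤ (k ^ k * n ^ (4 + Nat.primeCounting k)) ^ 3 := Nat.pow_le_pow_left h3 3
      _ = (k ^ 3) ^ k * n ^ (3 * (4 + Nat.primeCounting k)) := by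
        rw [mul_pow, ← pow_mul, ← pow_mul, ← pow_mul, mul_comm k 3, mul_comm 3 (4 + _)]
      _ ≤ (n ^ 2) ^ k * n ^ (3 * (4 + Nat.primeCounting k)) :=
        Nat.mul_le_mul_right _ (Nat.pow_le_pow_left h k)
      _ = _ := by rw [← pow_mul, ← pow_add]
  have h5 := (Nat.pow_le_pow_iff_right (show 1 < n by omega)).mp h4
  have := pi_bound k
  omega

lemma log_bound {k : ℕ} {t : ℝ} (ht : 4 ≤ t) (htk : t ^ 4 = k) :
    Real.log k ≤ 2 * t * Real.log 2 := by
  have hl2 : (1 / 2 : ℝ) < Real.log 2 := by have := Real.log_two_gt_d9; linarith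
  rw [← htk, Real.log_pow]
  have h1 : Real.log t = Real.log (t / 4) + 2 * Real.log 2 := by
    rw [Real.log_div (by linarith) (by norm_num), show (4 : ℝ) = 2 ^ 2 by norm_num, Real.log_pow]
    push_cast; ring
  have h2 := Real.log_le_sub_one_of_pos (show 0 < t / 4 by linarith)
  have h3 : 0 ≤ (t - 4) * (Real.log 2 - 1 / 2) := mul_nonneg (by linarith) (by linarith)
  push_cast
  nlinarith

lemma exists_root (k : ℕ) : ∃ t : ℝ, 0 ≤ t ∧ t ^ 4 = k :=
  ⟨Real.sqrt (Real.sqrt k), Real.sqrt_nonneg _, by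
    rw [show (4 : ℕ) = 2 * 2 by norm_num, pow_mul, Real.sq_sqrt (Real.sqrt_nonneg _),
      Real.sq_sqrt (Nat.cast_nonneg k)]⟩

/-- Case `16 k ≤ n < k ^ (3/2)`. -/
lemma case_iii {n k : ℕ} (hk : 1000 ≤ k) (hkn : 16 * k ≤ n) (h : n ^ 2 < k ^ 3) :
    FiveTerms n k := by
  by_contra hcon
  have h1 := upper_two (m := k) (by omega) (by omega) hcon (fun p _ h1 h2 => by omega)
  have h2 := pow_le_choose' (show k ≤ n by omega)
  set e := 4 + Nat.primeCounting (Nat.sqrt n) with he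
  have h3 : 4 ^ k ≤ n ^ e := by
    have h4 : (16 * k) ^ k ≤ k ^ k * (n ^ e * 4 ^ k) :=
      (Nat.pow_le_pow_left hkn k).trans (h2.trans (Nat.mul_le_mul_left _ h1))
    rw [mul_pow, mul_comm (16 ^ k), show 16 = 4 * 4 by norm_num, mul_pow] at h4
    exact Nat.le_of_mul_le_mul_right (Nat.le_of_mul_le_mul_left h4 (by positivity)) (by positivity)
  obtain ⟨t, ht0, htk⟩ := exists_root k
  have hkR : (1000 : ℝ) ≤ k := by exact_mod_cast hk
  have ht : 4 ≤ t := by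
    by_contra hlt
    have : t ^ 4 < 4 ^ 4 := pow_lt_pow_left₀ (by linarith) ht0 (by norm_num)
    linarith
  have hL := log_bound ht htk
  have hl2 : (1 / 2 : ℝ) < Real.log 2 := by have := Real.log_two_gt_d9; linarith
  have hnpos : (0 : ℝ) < n := by exact_mod_cast (show 0 < n by omega)
  have hlog : (k : ℝ) * (2 * Real.log 2) ≤ e * Real.log n := by
    have : ((4 : ℝ) ^ k) ≤ (n : ℝ) ^ e := by exact_mod_cast h3
    have := Real.log_le_log (by positivity) this
    rw [Real.log_pow, Real.log_pow, show (4 : ℝ) = 2 ^ 2 by norm_num, Real.log_pow] at this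
    exact_mod_cast this
  have hlogn : 2 * Real.log n ≤ 3 * Real.log k := by
    have : ((n : ℝ) ^ 2) ≤ (k : ℝ) ^ 3 := by exact_mod_cast h.le
    have := Real.log_le_log (by positivity) this
    rw [Real.log_pow, Real.log_pow] at this
    exact_mod_cast this
  have hs : (Nat.sqrt n : ℝ) ≤ t ^ 3 := by
    have h5 : (Nat.sqrt n) ^ 4 ≤ k ^ 3 := by
      calc (Nat.sqrt n) ^ 4 = ((Nat.sqrt n) ^ 2) ^ 2 := by ring
        _ ≤ n ^ 2 := Nat.pow_le_pow_left (Nat.sqrt_le' n) 2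
        _ ≤ _ := h.le
    have h6 : (Nat.sqrt n : ℝ) ^ 4 ≤ (t ^ 3) ^ 4 := by
      rw [← pow_mul, mul_comm 3 4, pow_mul, htk]
      exact_mod_cast h5
    exact le_of_pow_le_pow_left₀ (by norm_num) (by positivity) h6
  have hpi : 15 * (e : ℝ) ≤ 4 * t ^ 3 + 210 := by
    have := pi_bound (Nat.sqrt n)
    have h7 : 15 * e ≤ 4 * Nat.sqrt n + 210 := by omega
    have h8 : 15 * (e : ℝ) ≤ 4 * (Nat.sqrt n : ℝ) + 210 := by exact_mod_cast h7
    linarith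
  have hln : Real.log n ≤ 3 * t * Real.log 2 := by linarith
  have hlast : 15 * (k : ℝ) * (2 * Real.log 2) ≤ (4 * t ^ 3 + 210) * (3 * t * Real.log 2) := by
    calc 15 * (k : ℝ) * (2 * Real.log 2) ≤ 15 * (e * Real.log n) := by linarith
      _ = (15 * e) * Real.log n := by ring
      _ ≤ (15 * e) * (3 * t * Real.log 2) := by gcongr
      _ ≤ _ := by gcongr
  have h9 : 30 * t ^ 4 ≤ (4 * t ^ 3 + 210) * (3 * t) := by
    rw [← htk] at hlast
    refine le_of_mul_le_mul_right ?_ (show 0 < Real.log 2 by linarith)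
    linarith
  have h10 : (64 : ℝ) ≤ t ^ 3 := by
    have : (4 : ℝ) ^ 3 ≤ t ^ 3 := pow_le_pow_left₀ (by norm_num) ht 3
    linarith
  nlinarith

lemma final_numeric {n k : ℕ} (hk : 10000 ≤ k) (hkn : 2 * k ≤ n) (hn : n ≤ 16 * k)
    (h : 4 ^ (k - 1) ≤ n ^ (6 * (5 + Nat.primeCounting (Nat.sqrt n)))) : False := by
  set e := 5 + Nat.primeCounting (Nat.sqrt n) with he
  obtain ⟨t, ht0, htk⟩ := exists_root k
  have hkR : (10000 : ℝ) ≤ k := by exact_mod_cast hk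
  have ht : 10 ≤ t := by
    by_contra hlt
    have : t ^ 4 < 10 ^ 4 := pow_lt_pow_left₀ (by linarith) ht0 (by norm_num)
    linarith
  have hL := log_bound (by linarith) htk
  have hl2 : (1 / 2 : ℝ) < Real.log 2 := by have := Real.log_two_gt_d9; linarith
  have hnpos : (0 : ℝ) < n := by exact_mod_cast (show 0 < n by omega)
  have hlog : ((k : ℝ) - 1) * (2 * Real.log 2) ≤ 6 * e * Real.log n := by
    have : ((4 : ℝ) ^ (k - 1)) ≤ (n : ℝ) ^ (6 * e) := by exact_mod_cast h
    have := Real.log_le_log (by positivity) this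
    rw [Real.log_pow, Real.log_pow, show (4 : ℝ) = 2 ^ 2 by norm_num, Real.log_pow,
      Nat.cast_sub (by omega)] at this
    push_cast at this
    exact this
  have hnR : (n : ℝ) ≤ 16 * k := by exact_mod_cast hn
  have hlogn : Real.log n ≤ (4 + 2 * t) * Real.log 2 := by
    have := Real.log_le_log hnpos hnR
    rw [Real.log_mul (by norm_num) (by linarith), show (16 : ℝ) = 2 ^ 4 by norm_num,
      Real.log_pow] at this
    push_cast at this
    linarith
  have hs : (Nat.sqrt n : ℝ) ≤ 4 * t ^ 2 := by
    have h5 : (Nat.sqrt n : ℝ) ^ 2 ≤ n := by exact_mod_cast Nat.sqrt_le' n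
    have h6 : (Nat.sqrt n : ℝ) ^ 2 ≤ (4 * t ^ 2) ^ 2 := by
      calc _ ≤ _ := h5
        _ ≤ _ := hnR
        _ = _ := by rw [← htk]; ring
    exact le_of_pow_le_pow_left₀ (by norm_num) (by positivity) h6
  have hpi : 15 * (e : ℝ) ≤ 16 * t ^ 2 + 225 := by
    have := pi_bound (Nat.sqrt n)
    have h7 : 15 * e ≤ 4 * Nat.sqrt n + 225 := by omega
    have h8 : 15 * (e : ℝ) ≤ 4 * (Nat.sqrt n : ℝ) + 225 := by exact_mod_cast h7
    linarith
  have hlast : 15 * ((k : ℝ) - 1) * (2 * Real.log 2) ≤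
      6 * (16 * t ^ 2 + 225) * ((4 + 2 * t) * Real.log 2) := by
    calc 15 * ((k : ℝ) - 1) * (2 * Real.log 2) ≤ 15 * (6 * e * Real.log n) := by linarith
      _ = 6 * (15 * e) * Real.log n := by ring
      _ ≤ 6 * (15 * e) * ((4 + 2 * t) * Real.log 2) := by gcongr
      _ ≤ _ := by gcongr
  have h9 : 30 * (t ^ 4 - 1) ≤ 6 * (16 * t ^ 2 + 225) * (4 + 2 * t) := by
    rw [← htk] at hlast
    refine le_of_mul_le_mul_right ?_ (show 0 < Real.log 2 by linarith)
    linarith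
  obtain ⟨u, rfl⟩ : ∃ u, t = u + 10 := ⟨t - 10, by ring⟩
  have hu : 0 ≤ u := by linarith
  ring_nf at h9
  have := pow_nonneg hu 2
  have := pow_nonneg hu 3
  have := pow_nonneg hu 4
  linarith

lemma choose_growth (k : ℕ) : ∀ j : ℕ, 2 * j ≤ k →
    5 ^ j * (2 * k).choose k ≤ 3 ^ j * (2 * k + j).choose k := by
  intro j
  induction j with
  | zero => intro _; simp
  | succ j ih =>
    intro hj
    have h1 := ih (by omega)
    have h2 : 5 * (2 * k + j).choose k ≤ 3 * (2 * k + (j + 1)).choose k := by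
      have h4 := Nat.choose_mul_succ_eq (2 * k + j) k
      rw [show 2 * k + (j + 1) = 2 * k + j + 1 by ring]
      rw [show 2 * k + j + 1 - k = k + j + 1 by omega] at h4
      have h5 : 5 * (k + j + 1) ≤ 3 * (2 * k + j + 1) := by omega
      refine Nat.le_of_mul_le_mul_left ?_ (show 0 < k + j + 1 by omega)
      calc (k + j + 1) * (5 * (2 * k + j).choose k)
          = (5 * (k + j + 1)) * (2 * k + j).choose k := by ring
        _ ≤ (3 * (2 * k + j + 1)) * (2 * k + j).choose k := Nat.mul_le_mul_right _ h5
        _ = 3 * ((2 * k + j).choose k * (2 * k + j + 1)) := by ring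
        _ = _ := by rw [h4]; ring
    calc 5 ^ (j + 1) * (2 * k).choose k = 5 * (5 ^ j * (2 * k).choose k) := by ring
      _ ≤ 5 * (3 ^ j * (2 * k + j).choose k) := Nat.mul_le_mul_left _ h1
      _ = 3 ^ j * (5 * (2 * k + j).choose k) := by ring
      _ ≤ 3 ^ j * (3 * (2 * k + (j + 1)).choose k) := Nat.mul_le_mul_left _ h2
      _ = _ := by ring

lemma lower_growth {n k j : ℕ} (hk : 1 ≤ k) (hj : 2 * j ≤ k) (hn : 2 * k + j ≤ n) :
    5 ^ j * 4 ^ k ≤ n * 3 ^ j * n.choose k := by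
  have h1 := choose_growth k j hj
  have h2 := Nat.four_pow_le_two_mul_self_mul_centralBinom k hk
  rw [Nat.centralBinom_eq_two_mul_choose] at h2
  have h3 : (2 * k + j).choose k ≤ n.choose k := Nat.choose_le_choose k hn
  calc 5 ^ j * 4 ^ k ≤ 5 ^ j * (2 * k * (2 * k).choose k) := Nat.mul_le_mul_left _ h2
    _ = 2 * k * (5 ^ j * (2 * k).choose k) := by ring
    _ ≤ 2 * k * (3 ^ j * n.choose k) :=
      Nat.mul_le_mul_left _ (h1.trans (Nat.mul_le_mul_left _ h3))
    _ ≤ n * (3 ^ j * n.choose k) := Nat.mul_le_mul_right _ (by omega)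
    _ = _ := by ring

/-- Case `2 k ≤ n ≤ 16 k`, `k` large. -/
lemma case_i {n k : ℕ} (hk : 10000 ≤ k) (hkn : 2 * k ≤ n) (hn : n ≤ 16 * k) :
    FiveTerms n k := by
  by_contra hcon
  apply final_numeric hk hkn hn
  by_cases hc : 2 * (n - 2 * k) ≤ k
  · have h1 := upper_two (m := n / 3) (by omega) (by omega) hcon (fun p _ h1 h2 =>
      Nat.factorization_choose_of_lt_three_mul (by omega) h1 (by omega) (by omega))
    obtain ⟨j, rfl⟩ : ∃ j, n = 2 * k + j := ⟨n - 2 * k, by omega⟩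
    have h2 := lower_growth (n := 2 * k + j) (k := k) (j := j) (by omega) (by omega) le_rfl
    set n := 2 * k + j with hnd
    set e := Nat.primeCounting (Nat.sqrt n) with he
    have h3 : 5 ^ j * 4 ^ k ≤ 3 ^ j * (n ^ (5 + e) * 4 ^ (n / 3)) := by
      calc _ ≤ _ := h2
        _ ≤ n * 3 ^ j * (n ^ (4 + e) * 4 ^ (n / 3)) := Nat.mul_le_mul_left _ h1
        _ = _ := by ring
    have h4 := Nat.pow_le_pow_left h3 3
    have h5 : 108 ^ j * 4 ^ (3 * k) ≤ 27 ^ j * (n ^ (3 * (5 + e)) * 4 ^ (2 * k + j)) := by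
      calc 108 ^ j * 4 ^ (3 * k) ≤ 125 ^ j * 4 ^ (3 * k) :=
            Nat.mul_le_mul_right _ (Nat.pow_le_pow_left (by norm_num) j)
        _ = (5 ^ j * 4 ^ k) ^ 3 := by
            rw [mul_pow, ← pow_mul, ← pow_mul, mul_comm j 3, pow_mul 5 3 j, mul_comm k 3]; norm_num
        _ ≤ _ := h4
        _ = 27 ^ j * (n ^ (3 * (5 + e)) * 4 ^ (3 * (n / 3))) := by
            rw [mul_pow, mul_pow, ← pow_mul, ← pow_mul, ← pow_mul, mul_comm j 3, pow_mul 3 3 j,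
              mul_comm (5 + e) 3, mul_comm (n / 3) 3]; norm_num
        _ ≤ _ := by
            apply Nat.mul_le_mul_left
            apply Nat.mul_le_mul_left
            exact Nat.pow_le_pow_right (by norm_num) (by omega)
    have h6 : 4 ^ k ≤ n ^ (3 * (5 + e)) := by
      have h7 : (108 : ℕ) ^ j = 27 ^ j * 4 ^ j := by rw [← mul_pow]; norm_num
      have h8 : (27 ^ j * 4 ^ (2 * k + j)) * 4 ^ k ≤ (27 ^ j * 4 ^ (2 * k + j)) * n ^ (3 * (5 + e)) := by
        calc (27 ^ j * 4 ^ (2 * k + j)) * 4 ^ k = 108 ^ j * 4 ^ (3 * k) := by rw [h7]; ring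
          _ ≤ _ := h5
          _ = _ := by ring
      exact Nat.le_of_mul_le_mul_left h8 (by positivity)
    calc 4 ^ (k - 1) ≤ 4 ^ k := Nat.pow_le_pow_right (by norm_num) (by omega)
      _ ≤ _ := h6
      _ ≤ _ := Nat.pow_le_pow_right (by omega) (by omega)
  · have h1 := upper_two (m := k) (by omega) (by omega) hcon (fun p _ h1 h2 => by omega)
    have h2 := lower_growth (n := n) (k := k) (j := k / 2) (by omega) (by omega) (by omega)
    set j := k / 2 with hj
    set e := Nat.primeCounting (Nat.sqrt n) with he
    have h3 : 5 ^ j ≤ 3 ^ j * n ^ (5 + e) := by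
      refine Nat.le_of_mul_le_mul_right ?_ (show 0 < 4 ^ k by positivity)
      calc _ ≤ _ := h2
        _ ≤ n * 3 ^ j * (n ^ (4 + e) * 4 ^ k) := Nat.mul_le_mul_left _ h1
        _ = _ := by ring
    have h4 : 4 ^ j ≤ n ^ (3 * (5 + e)) := by
      refine Nat.le_of_mul_le_mul_left ?_ (show 0 < 27 ^ j by positivity)
      calc 27 ^ j * 4 ^ j = 108 ^ j := by rw [← mul_pow]; norm_num
        _ ≤ 125 ^ j := Nat.pow_le_pow_left (by norm_num) j
        _ = (5 ^ j) ^ 3 := by rw [← pow_mul, mul_comm j 3, pow_mul]; norm_num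
        _ ≤ (3 ^ j * n ^ (5 + e)) ^ 3 := Nat.pow_le_pow_left h3 3
        _ = _ := by
            rw [mul_pow, ← pow_mul, ← pow_mul, mul_comm j 3, pow_mul 3 3 j, mul_comm (5 + e) 3]
            norm_num
    calc 4 ^ (k - 1) ≤ 4 ^ (j * 2) := Nat.pow_le_pow_right (by norm_num) (by omega)
      _ = (4 ^ j) ^ 2 := by rw [pow_mul]
      _ ≤ (n ^ (3 * (5 + e))) ^ 2 := Nat.pow_le_pow_left h4 2
      _ = _ := by rw [← pow_mul]; congr 1; ring

lemma five_of_finset {n k : ℕ} (I : Finset ℕ) (hc : I.card = 5)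
    (h : ∀ x ∈ I, n < x + k ∧ x ≤ n ∧ ∃ p : ℕ, p.Prime ∧ k < p ∧ p ∣ x) : FiveTerms n k := by
  refine ⟨I.image (fun x => n - x), ?_, ?_⟩
  · rw [Finset.card_image_of_injOn, hc]
    intro x hx y hy hxy
    have h1 := h x hx
    have h2 := h y hy
    simp only at hxy
    omega
  · intro i hi
    obtain ⟨x, hx, rfl⟩ := Finset.mem_image.mp hi
    obtain ⟨h1, h2, p, hp, hkp, hd⟩ := h x hx
    refine ⟨by omega, p, hp, hkp, ?_⟩
    rwa [show n - (n - x) = x by omega]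

/-- No divisor `d` of `p` with `2 ≤ d ≤ b` and `d * d ≤ p`. -/
def noDiv (p : ℕ) : ℕ → Bool
  | 0 => true
  | d + 1 => (Nat.beq d 0 || Nat.blt p ((d + 1) * (d + 1)) || Nat.blt 0 (p % (d + 1))) && noDiv p d

lemma noDiv_spec (p : ℕ) : ∀ b, noDiv p b = true → ∀ d, 2 ≤ d → d ≤ b → d * d ≤ p → ¬ d ∣ p := by
  intro b
  induction b with
  | zero => intro _ d h1 h2; omega
  | succ b ih =>
    intro h d h1 h2 h3 hd
    simp only [noDiv, Bool.and_eq_true, Bool.or_eq_true, Nat.beq_eq, Nat.blt_eq] at h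
    obtain ⟨h4, h5⟩ := h
    by_cases hb : d = b + 1
    · subst hb
      have := Nat.mod_eq_zero_of_dvd hd
      omega
    · exact ih h5 d h1 (by omega) h3 hd

/-- Primality by trial division, for `p < 411 ^ 2`. -/
def isP (p : ℕ) : Bool := Nat.blt 1 p && Nat.blt p 168921 && noDiv p 410

lemma isP_spec {p : ℕ} (h : isP p = true) : p.Prime := by
  simp only [isP, Bool.and_eq_true, Nat.blt_eq] at h
  obtain ⟨⟨h1, h2⟩, h3⟩ := h
  by_contra hp
  have h4 := Nat.minFac_sq_le_self (show 0 < p by omega) hp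
  rw [pow_two] at h4
  have h5 := (Nat.minFac_prime (show p ≠ 1 by omega)).two_le
  refine noDiv_spec p 410 h3 _ h5 ?_ h4 (Nat.minFac_dvd p)
  by_contra h6
  have : 411 * 411 ≤ p.minFac * p.minFac := Nat.mul_le_mul (by omega) (by omega)
  omega

/-- Consecutive runs of six rungs of the ladder are short. -/
def ladderOK : List ℕ → ℕ → ℕ → ℕ → ℕ → ℕ → Bool
  | [], _, _, _, _, _ => true
  | f :: t, a, b, c, d, e =>
    Nat.blt e f && isP f && (Nat.ble f (a + 100) || Nat.ble (16 * f) (16 * a + e)) &&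
      ladderOK t b c d e f

lemma ladder_spec {n k : ℕ} (hk : 100 ≤ k) (hkn : 2 * k ≤ n) (hn : n ≤ 16 * k) :
    ∀ (l : List ℕ) (a b c d e : ℕ), ladderOK l a b c d e = true → a < b → b < c → c < d → d < e →
      a.Prime → b.Prime → c.Prime → d.Prime → e.Prime → e ≤ n → (∃ x ∈ l, n < x) →
      FiveTerms n k := by
  intro l
  induction l with
  | nil => intro a b c d e _ _ _ _ _ _ _ _ _ _ _ h; simp at h
  | cons f t ih =>
    intro a b c d e h hab hbc hcd hde ha hb hc hd he hen hx
    simp only [ladderOK, Bool.and_eq_true, Bool.or_eq_true, Nat.blt_eq, Nat.ble_eq] at h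
    obtain ⟨⟨⟨hef, hf⟩, hspan⟩, hrest⟩ := h
    by_cases hnf : n < f
    · apply five_of_finset {a, b, c, d, e}
      · rw [Finset.card_insert_of_notMem, Finset.card_insert_of_notMem,
          Finset.card_insert_of_notMem, Finset.card_insert_of_notMem, Finset.card_singleton]
        all_goals simp only [Finset.mem_insert, Finset.mem_singleton]; omega
      · intro x hxm
        simp only [Finset.mem_insert, Finset.mem_singleton] at hxm
        have hax : a ≤ x := by omega
        have hp : x.Prime := by rcases hxm with rfl | rfl | rfl | rfl | rfl <;> assumption
        exact ⟨by omega, by omega, x, hp, by omega, dvd_rfl⟩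
    · refine ih b c d e f hrest hbc hcd hde hef hb hc hd he (isP_spec hf) (by omega) ?_
      obtain ⟨x, hxm, hxn⟩ := hx
      rcases List.mem_cons.mp hxm with rfl | hxt
      · omega
      · exact ⟨x, hxt, hxn⟩

/-- A sparse ladder of primes. -/
def ladder : List ℕ :=
  [
    193, 211, 229, 241, 257, 277, 293, 313, 331, 349, 367, 383, 401,
    421, 439, 457, 467, 487, 503, 523, 541, 557, 577, 593, 613, 631, 647, 661, 677, 691, 709,
    727, 743, 761, 773, 787, 797, 811, 829, 839, 859, 877, 887, 907, 919, 937, 953, 971, 991,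
    1009, 1021, 1039, 1051, 1069, 1087, 1103, 1123, 1129, 1151, 1171, 1187, 1201, 1217, 1237,
    1249, 1259, 1277, 1279, 1283, 1289, 1291, 1297, 1301, 1303, 1307, 1319, 1321, 1327, 1361,
    1367, 1373, 1381, 1399, 1409, 1423, 1427, 1429, 1447, 1459, 1471, 1489, 1499, 1511, 1531,
    1549, 1567, 1583, 1601, 1621, 1637, 1657, 1669, 1693, 1709, 1723, 1741, 1759, 1777, 1789,
    1811, 1831, 1847, 1867, 1889, 1907, 1913, 1933, 1951, 1973, 1997, 2017, 2039, 2063, 2087,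
    2113, 2137, 2161, 2179, 2203, 2221, 2243, 2269, 2297, 2311, 2339, 2357, 2383, 2411, 2441,
    2467, 2477, 2503, 2531, 2557, 2579, 2609, 2633, 2663, 2693, 2719, 2749, 2777, 2803, 2837,
    2861, 2887, 2917, 2953, 2971, 3001, 3037, 3067, 3089, 3121, 3137, 3169, 3203, 3229, 3259,
    3299, 3331, 3371, 3413, 3449, 3491, 3533, 3571, 3613, 3643, 3677, 3719, 3761, 3803, 3847,
    3889, 3931, 3967, 4013, 4057, 4099, 4139, 4177, 4229, 4273, 4297, 4349, 4397, 4451, 4493,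
    4549, 4603, 4657, 4703, 4759, 4817, 4877, 4937, 4993, 5051, 5113, 5171, 5233, 5297, 5351,
    5417, 5483, 5531, 5591, 5659, 5717, 5783, 5851, 5923, 5987, 6053, 6121, 6197, 6271, 6343,
    6421, 6491, 6571, 6653, 6733, 6803, 6883, 6967, 7043, 7129, 7213, 7297, 7369, 7459, 7549,
    7643, 7727, 7823, 7919, 8017, 8117, 8209, 8311, 8389, 8467, 8563, 8669, 8761, 8867, 8971,
    9067, 9173, 9283, 9397, 9511, 9629, 9749, 9859, 9973, 10093, 10211, 10337, 10463, 10589,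
    10711, 10837, 10957, 11093, 11213, 11353, 11491, 11633, 11777, 11923, 12071, 12211, 12347,
    12497, 12653, 12809, 12967, 13127, 13291, 13457, 13619, 13789, 13933, 14107, 14281, 14449,
    14629, 14797, 14969, 15149, 15331, 15511, 15683, 15877, 16073, 16273, 16453, 16657, 16843,
    17053, 17257, 17471, 17683, 17903, 18121, 18341, 18553, 18773, 19001, 19237, 19477, 19717,
    19963, 20201, 20443, 20693, 20947, 21193, 21433, 21683, 21943, 22193, 22469, 22741, 23021,
    23297, 23581, 23873, 24169, 24469, 24767, 25073, 25373, 25679, 25999, 26321, 26647, 26959,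
    27283, 27617, 27961, 28309, 28661, 29017, 29363, 29723, 30091, 30467, 30841, 31223, 31607,
    31991, 32381, 32783, 33191, 33601, 34019, 34439, 34849, 35281, 35677, 36109, 36559, 37013,
    37463, 37907, 38377, 38851, 39323, 39799, 40289, 40787, 41281, 41777, 42299, 42821, 43331,
    43867, 44389, 44939, 45497, 46061, 46633, 47207, 47797, 48383, 48973, 49559, 50177, 50789,
    51421, 52057, 52697, 53353, 54013, 54679, 55351, 56041, 56737, 57427, 58129, 58831, 59561,
    60293, 61043, 61781, 62549, 63317, 64091, 64891, 65701, 66509, 67339, 68171, 69019, 69877,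
    70729, 71597, 72481, 73387, 74297, 75223, 76163, 77101, 78059, 79031, 79999, 80989, 81973,
    82997, 84017, 85061, 86117, 87187, 88261, 89363, 90473, 91591, 92723, 93871, 95027, 96211,
    97397, 98597, 99829, 101063, 102317, 103591, 104879, 106189, 107509, 108827, 110183, 111539,
    112927, 114329, 115757, 117203, 118661, 120121, 121621, 123127, 124643, 126199, 127763,
    129347, 130957, 132589, 134243, 135913, 137597, 139313, 141041, 142799, 144583, 146389,
    148207, 150053, 151909, 153763, 155671, 157579, 159541, 161531]

lemma ladder_ok : ladderOK ladder 109 127 139 157 173 = true := by decide +kernel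

lemma case_ladder {n k : ℕ} (hk : 100 ≤ k) (hkn : 2 * k ≤ n) (hn : n ≤ 16 * k)
    (hn' : n ≤ 160000) : FiveTerms n k :=
  ladder_spec hk hkn hn ladder 109 127 139 157 173 ladder_ok (by norm_num) (by norm_num)
    (by norm_num) (by norm_num) (by norm_num) (by norm_num) (by norm_num) (by norm_num)
    (by norm_num) (by omega) ⟨161531, by decide +kernel, by omega⟩

/-- `k` is visibly composite. -/
def comp (k : ℕ) : Bool :=
  [2, 3, 5, 7, 11, 13, 17, 19, 23, 29, 31].any (fun d => Nat.blt d k && Nat.beq (k % d) 0)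

lemma comp_spec {k : ℕ} (h : comp k = true) : ¬ k.Prime := by
  simp only [comp, List.any_eq_true, Bool.and_eq_true, Nat.blt_eq, Nat.beq_eq] at h
  obtain ⟨d, hd, hlt, hm⟩ := h
  intro hp
  have h1 := (Nat.dvd_prime hp).mp (Nat.dvd_of_mod_eq_zero hm)
  rcases h1 with rfl | rfl
  · simp at hd
  · omega

/-- The inequality which makes the counting argument work from `max 400 (4 * k)` on. -/
def exTest (k f q : ℕ) : Bool :=
  Nat.blt (f * (400 + (4 * k - 400)) ^ (q + 4)) ((400 + (4 * k - 400) + 1 - k) ^ k) &&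
    Nat.ble (q + 4) k

/-- Check `exTest` for `1000 - s ≤ k < 1000`. -/
def exa : ℕ → ℕ → ℕ → Bool
  | 0, _, _ => true
  | s + 1, f, q => exTest (999 - s) f q &&
    (match f * (1000 - s) with
      | 0 => false
      | f' + 1 => match (bif comp (1000 - s) then q else q + 1) with
        | 0 => false
        | q' + 1 => exa s (f' + 1) (q' + 1))

lemma exa_spec : ∀ s f q : ℕ, s ≤ 981 → exa s f q = true → f = (1000 - s).factorial →
    Nat.primeCounting (1000 - s) ≤ q → ∀ k, 1000 - s ≤ k → k < 1000 →
    ∃ q', Nat.primeCounting k ≤ q' ∧ exTest k k.factorial q' = true := by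
  intro s
  induction s with
  | zero => intro f q _ _ _ _ k h1 h2; omega
  | succ s ih =>
    intro f q hs h hf hq k hk1 hk2
    rw [exa, Bool.and_eq_true] at h
    obtain ⟨h1, h2⟩ := h
    have hs1 : 1000 - (s + 1) = 999 - s := by omega
    have hs2 : 1000 - s = (999 - s) + 1 := by omega
    rw [hs1] at hf hq hk1
    by_cases hk : k = 999 - s
    · subst hk
      exact ⟨q, hq, hf ▸ h1⟩
    · split at h2
      · simp at h2
      · rename_i f' hf'
        split at h2
        · simp at h2
        · rename_i q' hq'
          refine ih _ _ (by omega) h2 ?_ ?_ k (by omega) hk2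
          · rw [← Nat.succ_eq_add_one, ← hf', hf, hs2, Nat.factorial_succ, mul_comm]
          · rw [← Nat.succ_eq_add_one, ← hq', hs2, Nat.primeCounting, Nat.primeCounting',
              Nat.count_succ]
            change Nat.primeCounting (999 - s) + _ ≤ _
            cases hcomp : comp (999 - s + 1) with
            | true =>
              rw [if_neg (comp_spec hcomp)]
              simpa using hq
            | false =>
              simp only [cond_false]
              split_ifs <;> omega

lemma exa_ok : exa 981 121645100408832000 8 = true := by decide +kernel

lemma mono_ineq {X E k n₀ : ℕ} (hE : E ≤ k) (hk : 1 ≤ k) (hkn : k ≤ n₀)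
    (h : X * n₀ ^ E < (n₀ + 1 - k) ^ k) : ∀ n, n₀ ≤ n → X * n ^ E < (n + 1 - k) ^ k := by
  intro n hn
  induction n, hn using Nat.le_induction with
  | base => exact h
  | succ n hn ih =>
    have hnpos : 0 < n := by omega
    refine Nat.lt_of_mul_lt_mul_right (a := n ^ k) ?_
    have h1 : (n + 1) ^ E * n ^ (k - E) ≤ (n + 1) ^ k := by
      calc (n + 1) ^ E * n ^ (k - E) ≤ (n + 1) ^ E * (n + 1) ^ (k - E) :=
            Nat.mul_le_mul_left _ (Nat.pow_le_pow_left (by omega) _)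
        _ = (n + 1) ^ k := by rw [← pow_add]; congr 1; omega
    have h2 : (n + 1 - k) * (n + 1) ≤ (n + 1 + 1 - k) * n := by
      obtain ⟨m, rfl⟩ : ∃ m, n = k + m := ⟨n - k, by omega⟩
      rw [show k + m + 1 - k = m + 1 by omega, show k + m + 1 + 1 - k = m + 2 by omega]
      nlinarith
    calc X * (n + 1) ^ E * n ^ k = X * n ^ E * ((n + 1) ^ E * n ^ (k - E)) := by
          rw [show n ^ k = n ^ E * n ^ (k - E) by rw [← pow_add]; congr 1; omega]; ring
      _ ≤ X * n ^ E * (n + 1) ^ k := Nat.mul_le_mul_left _ h1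
      _ < (n + 1 - k) ^ k * (n + 1) ^ k := Nat.mul_lt_mul_of_pos_right ih (by positivity)
      _ = ((n + 1 - k) * (n + 1)) ^ k := by rw [mul_pow]
      _ ≤ ((n + 1 + 1 - k) * n) ^ k := Nat.pow_le_pow_left h2 k
      _ = _ := by rw [mul_pow]

lemma case_exact {n k : ℕ} (hk : 19 ≤ k) (hk' : k < 1000) (hn : 400 ≤ n) (hn' : 4 * k ≤ n) :
    FiveTerms n k := by
  by_contra hcon
  have hpi : Nat.primeCounting 19 = 8 := by decide +kernel
  obtain ⟨q, hq, ht⟩ := exa_spec 981 _ _ le_rfl exa_ok (by decide +kernel) hpi.le k (by omega) hk'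
  simp only [exTest, Bool.and_eq_true, Nat.blt_eq, Nat.ble_eq] at ht
  have h1 := mono_ineq ht.2 (by omega) (by omega) ht.1 n (by omega)
  have h2 := upper_one (by omega) (by omega) hcon
  have h3 : (n + 1 - k) ^ k ≤ k.factorial * n.choose k := by
    rw [← Nat.descFactorial_eq_factorial_mul_choose]
    exact Nat.pow_sub_le_descFactorial n k
  have h4 : n ^ (4 + Nat.primeCounting k) ≤ n ^ (q + 4) :=
    Nat.pow_le_pow_right (by omega) (by omega)
  have h5 := Nat.mul_le_mul_left k.factorial (h2.trans h4)
  omega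

/-- Largest prime factors of `399, 398, …, 1`. -/
def lpTable : List ℕ :=
  [
    19, 199, 397, 11, 79, 197, 131, 7, 23, 13, 389, 97, 43, 193, 11, 3, 383, 191, 127, 19, 379,
    7, 29, 47, 5, 17, 373, 31, 53, 37, 41, 23, 367, 61, 73, 13, 11, 181, 19, 5, 359, 179, 17,
    89, 71, 59, 353, 11, 13, 7, 349, 29, 347, 173, 23, 43, 7, 19, 31, 17, 113, 13, 337, 7, 67,
    167, 37, 83, 331, 11, 47, 41, 109, 163, 13, 3, 19, 23, 107, 5, 29, 53, 317, 79, 7, 157, 313,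
    13, 311, 31, 103, 11, 307, 17, 61, 19, 101, 151, 43, 5, 23, 149, 11, 37, 59, 7, 293, 73, 97,
    29, 17, 3, 41, 13, 19, 71, 283, 47, 281, 7, 31, 139, 277, 23, 11, 137, 13, 17, 271, 5, 269,
    67, 89, 19, 53, 11, 263, 131, 29, 13, 37, 43, 257, 2, 17, 127, 23, 7, 251, 5, 83, 31, 19,
    41, 7, 61, 3, 11, 241, 5, 239, 17, 79, 59, 47, 13, 233, 29, 11, 23, 229, 19, 227, 113, 5, 7,
    223, 37, 17, 11, 73, 109, 31, 3, 43, 107, 71, 53, 211, 7, 19, 13, 23, 103, 41, 17, 29, 101,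
    67, 5, 199, 11, 197, 7, 13, 97, 193, 3, 191, 19, 7, 47, 17, 31, 37, 23, 61, 13, 181, 5, 179,
    89, 59, 11, 7, 29, 173, 43, 19, 17, 13, 7, 167, 83, 11, 41, 163, 3, 23, 5, 53, 79, 157, 13,
    31, 11, 17, 19, 151, 5, 149, 37, 7, 73, 29, 3, 13, 71, 47, 7, 139, 23, 137, 17, 5, 67, 19,
    11, 131, 13, 43, 2, 127, 7, 5, 31, 41, 61, 11, 5, 17, 59, 13, 29, 23, 19, 113, 7, 37, 11,
    109, 3, 107, 53, 7, 13, 103, 17, 101, 5, 11, 7, 97, 3, 19, 47, 31, 23, 13, 5, 89, 11, 29,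
    43, 17, 7, 83, 41, 3, 5, 79, 13, 11, 19, 5, 37, 73, 3, 71, 7, 23, 17, 67, 11, 13, 2, 7, 31,
    61, 5, 59, 29, 19, 7, 11, 3, 53, 13, 17, 5, 7, 3, 47, 23, 5, 11, 43, 7, 41, 5, 13, 19, 37,
    3, 7, 17, 11, 2, 31, 5, 29, 7, 3, 13, 5, 3, 23, 11, 7, 5, 19, 3, 17, 2, 5, 7, 13, 3, 11, 5,
    3, 2, 7, 3, 5, 2, 3, 2, 1]

/-- The entries of the table are prime factors of `m, m - 1, …`. -/
def tableOK : List ℕ → ℕ → Bool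
  | [], _ => true
  | _ :: _, 0 => false
  | p :: t, m + 1 => (Nat.ble p 1 || (isP p && Nat.beq ((m + 1) % p) 0)) && tableOK t m

/-- Are there `c` numbers in `(lo, m]` with a prime factor exceeding `k`? -/
def go (k lo : ℕ) : List ℕ → ℕ → ℕ → Bool
  | _, _, 0 => true
  | [], _, _ + 1 => false
  | _ :: _, 0, _ + 1 => false
  | p :: t, m + 1, c + 1 =>
    bif Nat.ble (m + 1) lo then false else
      bif Nat.blt k p then go k lo t m c else go k lo t m (c + 1)

/-- The true exceptions. -/
def exc (n k : ℕ) : Bool :=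
  (Nat.beq k 19 && (Nat.beq n 38 || Nat.beq n 39 || Nat.beq n 40 || Nat.beq n 42)) ||
    (Nat.beq k 20 && Nat.beq n 40)

/-- Check all `n` below a bound for a fixed `k`. -/
def chk (k : ℕ) : List ℕ → ℕ → Bool
  | [], _ => true
  | _ :: _, 0 => true
  | p :: t, n + 1 => bif Nat.blt (n + 1) (2 * k) then true else
      (exc (n + 1) k || go k (n + 1 - k) (p :: t) (n + 1) 5) && chk k t n

lemma go_spec {k lo : ℕ} (hk : 1 ≤ k) : ∀ (l : List ℕ) (m c : ℕ), tableOK l m = true →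
    go k lo l m c = true →
    ∃ I : Finset ℕ, I.card = c ∧ ∀ x ∈ I, lo < x ∧ x ≤ m ∧ ∃ p : ℕ, p.Prime ∧ k < p ∧ p ∣ x := by
  intro l
  induction l with
  | nil =>
    intro m c _ h
    cases c with
    | zero => exact ⟨∅, by simp⟩
    | succ c => simp [go] at h
  | cons p t ih =>
    intro m c ht h
    cases c with
    | zero => exact ⟨∅, by simp⟩
    | succ c =>
      cases m with
      | zero => simp [go] at h
      | succ m =>
        rw [tableOK, Bool.and_eq_true] at ht
        obtain ⟨ht1, ht2⟩ := ht
        rw [go] at h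
        cases hb : Nat.ble (m + 1) lo with
        | true => rw [hb] at h; simp at h
        | false =>
          rw [hb, cond_false] at h
          have hlo : lo < m + 1 := by
            by_contra hcon
            have := Nat.ble_eq.mpr (show m + 1 ≤ lo by omega)
            rw [hb] at this
            simp at this
          cases hq : Nat.blt k p with
          | true =>
            rw [hq, cond_true] at h
            obtain ⟨I, hI, hx⟩ := ih m c ht2 h
            have hkp : k < p := Nat.blt_eq.mp hq
            simp only [Bool.or_eq_true, Bool.and_eq_true, Nat.ble_eq, Nat.beq_eq] at ht1
            have ht3 : isP p = true ∧ (m + 1) % p = 0 := by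
              rcases ht1 with h | h
              · omega
              · exact h
            refine ⟨insert (m + 1) I, ?_, ?_⟩
            · rw [Finset.card_insert_of_notMem, hI]
              intro hmem
              have := (hx _ hmem).2.1
              omega
            · intro x hxm
              rcases Finset.mem_insert.mp hxm with rfl | hxI
              · exact ⟨hlo, le_rfl, p, isP_spec ht3.1, hkp, Nat.dvd_of_mod_eq_zero ht3.2⟩
              · obtain ⟨h1, h2, h3⟩ := hx x hxI
                exact ⟨h1, by omega, h3⟩
          | false =>
            rw [hq, cond_false] at h
            obtain ⟨I, hI, hx⟩ := ih m (c + 1) ht2 h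
            refine ⟨I, hI, fun x hxI => ?_⟩
            obtain ⟨h1, h2, h3⟩ := hx x hxI
            exact ⟨h1, by omega, h3⟩

lemma chk_spec {k : ℕ} (hk : 1 ≤ k) : ∀ (l : List ℕ) (N : ℕ), l.length = N → tableOK l N = true →
    chk k l N = true → ∀ n, n ≤ N → 2 * k ≤ n → exc n k = true ∨ FiveTerms n k := by
  intro l
  induction l with
  | nil => intro N hN _ _ n h1 h2; simp at hN; omega
  | cons p t ih =>
    intro N hN ht h n hn hkn
    cases N with
    | zero => simp at hN
    | succ N =>
      have ht' := ht
      rw [tableOK, Bool.and_eq_true] at ht'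
      rw [chk] at h
      cases hb : Nat.blt (N + 1) (2 * k) with
      | true =>
        have := Nat.blt_eq.mp hb
        omega
      | false =>
        rw [hb, cond_false, Bool.and_eq_true, Bool.or_eq_true] at h
        by_cases hnN : n = N + 1
        · subst hnN
          rcases h.1 with h1 | h1
          · exact Or.inl h1
          · right
            obtain ⟨I, hI, hx⟩ := go_spec hk _ _ _ ht h1
            refine five_of_finset I hI (fun x hxI => ?_)
            obtain ⟨h1, h2, h3⟩ := hx x hxI
            exact ⟨by omega, h2, h3⟩
        · exact ih N (by simpa using hN) ht'.2 h.2 n (by omega) hkn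

lemma table_ok : tableOK lpTable 399 = true := by decide +kernel

lemma chk_ok : (List.range 81).all (fun i => chk (i + 19) lpTable 399) = true := by decide +kernel

lemma case_small {n k : ℕ} (hk : 19 ≤ k) (hk' : k < 100) (hkn : 2 * k ≤ n) (hn : n < 400) :
    exc n k = true ∨ FiveTerms n k := by
  refine chk_spec (by omega) lpTable 399 (by decide +kernel) table_ok ?_ n (by omega) hkn
  have := List.all_eq_true.mp chk_ok (k - 19) (List.mem_range.mpr (by omega))
  rwa [show k - 19 + 19 = k by omega] at this

theorem five_terms_with_large_prime_factor (n k : ℕ) (hk : 38 ≤ 2 * k) (hn : 2 * k ≤ n)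
    (hT : (n, k) ∉ T) :
    ∃ I : Finset ℕ, I.card = 5 ∧ ∀ i ∈ I, i ≤ k - 1 ∧
      ∃ p : ℕ, p.Prime ∧ k < p ∧ p ∣ (n - i) := by
  change FiveTerms n k
  have hk19 : 19 ≤ k := by omega
  by_cases h1 : k < 100
  · by_cases h2 : n < 400
    · rcases case_small hk19 h1 hn h2 with h | h
      · exfalso
        apply hT
        simp only [exc, Bool.or_eq_true, Bool.and_eq_true, Nat.beq_eq] at h
        rcases h with ⟨rfl, ((rfl | rfl) | rfl) | rfl⟩ | ⟨rfl, rfl⟩ <;> unfold T <;>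
          first
          | exact Set.mem_insert _ _
          | exact Set.mem_insert_of_mem _ (Set.mem_insert _ _)
          | exact Set.mem_insert_of_mem _ (Set.mem_insert_of_mem _ (Set.mem_insert _ _))
          | exact Set.mem_insert_of_mem _ (Set.mem_insert_of_mem _ (Set.mem_insert_of_mem _
              (Set.mem_insert _ _)))
          | exact Set.mem_insert_of_mem _ (Set.mem_insert_of_mem _ (Set.mem_insert_of_mem _
              (Set.mem_insert_of_mem _ (Set.mem_insert _ _))))
      · exact h
    · exact case_exact hk19 (by omega) (by omega) (by omega)
  · by_cases h3 : n ≤ 16 * k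
    · by_cases h4 : 10000 ≤ k
      · exact case_i h4 hn h3
      · exact case_ladder (by omega) hn h3 (by omega)
    · by_cases h5 : k < 1000
      · exact case_exact hk19 h5 (by omega) (by omega)
      · by_cases h6 : k ^ 3 ≤ n ^ 2
        · exact case_iv (by omega) (by omega) h6
        · exact case_iii (by omega) (by omega) (by omega)
end

section
/- Let (n,k) be a pair in S ∪ T with k ≥ 4 and (n,k) ∉ S' = {(10,5), (12,6), (16,8)}. Then for every choice of nonzero integers a_0, a_1, …, a_k each of which has all of its prime factors ≤ k, the polynomial F_{n,k}(x) = ∑_{j=0}^{k} a_j c_j x^j is irreducible over ℚ. -/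
open Polynomial

/-- `c n k j = (−1)^{k−j} C(n,j) C(n−j−1, k−j)`, the `j`-th coefficient of `P_{n,k}(x−1)`. -/
def c (n k j : ℕ) : ℤ :=
  (-1) ^ (k - j) * (n.choose j : ℤ) * ((n - j - 1).choose (k - j) : ℤ)

/-- `F n k a = ∑_{j=0}^{k} a_j c_j x^j` as a polynomial over `ℚ`. -/
noncomputable def F (n k : ℕ) (a : ℕ → ℤ) : Polynomial ℚ :=
  ∑ j ∈ Finset.range (k + 1), Polynomial.C ((a j * c n k j : ℤ) : ℚ) * Polynomial.X ^ j

/-- The exceptional set `S` of pairs `(n, k)`, given as the union of the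
sets `[n, k, h] = {(n, k), (n+1, k), …, (n+h−1, k)}` listed in the paper. -/
def S : Set (ℕ × ℕ) :=
  {(6, 3), (8, 3), (9, 3), (10, 3), (18, 3), (9, 4), (10, 5), (11, 5), (12, 5), (13, 5), (16,
    5), (18, 5), (19, 5), (20, 5), (27, 5), (28, 5), (12, 6), (13, 6), (20, 6), (14, 7), (15,
    7), (16, 7), (18, 7), (20, 7), (21, 7), (30, 7), (16, 8), (21, 8), (26, 13), (27, 13), (28,
    13), (30, 13), (32, 13), (33, 13), (36, 13), (28, 14), (33, 14), (36, 17)}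

/-- A monic-up-to-unit factor of a monomial modulo `p` is a monomial modulo `p`. -/
lemma mono_of_dvd (p : ℕ) [Fact p.Prime] (g : ℤ[X]) (u : ZMod p) (hu : u ≠ 0) (m : ℕ)
    (h : g.map (Int.castRingHom (ZMod p)) ∣ C u * X ^ m) :
    ∃ s, ∃ v : ZMod p, v ≠ 0 ∧ g.map (Int.castRingHom (ZMod p)) = C v * X ^ s := by
  have h1 : g.map (Int.castRingHom (ZMod p)) ∣ X ^ m := by
    have hC : IsUnit (C u : (ZMod p)[X]) := isUnit_C.mpr (isUnit_iff_ne_zero.mpr hu)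
    exact (hC.dvd_mul_left).mp h
  obtain ⟨s, -, hs⟩ := (dvd_prime_pow (prime_X (R := ZMod p)) m).mp h1
  obtain ⟨w, hw⟩ := hs.symm
  obtain ⟨r, hr, hrw⟩ := Polynomial.isUnit_iff.mp w.isUnit
  exact ⟨s, r, hr.ne_zero, by rw [← hw, ← hrw, mul_comm]⟩

lemma coeff_of_map (p : ℕ) [Fact p.Prime] (g : ℤ[X]) (v : ZMod p) (hv : v ≠ 0) (s : ℕ)
    (h : g.map (Int.castRingHom (ZMod p)) = C v * X ^ s) :
    (∀ i, i ≠ s → (p : ℤ) ∣ g.coeff i) ∧ ¬ (p : ℤ) ∣ g.coeff s := by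
  have key : ∀ i, ((g.coeff i : ℤ) : ZMod p) = if i = s then v else 0 := by
    intro i
    have := congrArg (fun q => coeff q i) h
    simpa [coeff_map, coeff_C_mul, coeff_X_pow] using this
  constructor
  · intro i hi
    rw [← ZMod.intCast_zmod_eq_zero_iff_dvd, key i, if_neg hi]
  · rw [← ZMod.intCast_zmod_eq_zero_iff_dvd, key s, if_pos rfl]
    exact hv

/-- The Newton polygon constraint on the degree of a factor. -/
lemma degree_constraint (p : ℕ) (hp : p.Prime) (f g h : ℤ[X]) (hf : f = g * h) (hf0 : f ≠ 0)
    (m : ℕ) (hd : ∀ i, i ≠ m → (p : ℤ) ∣ f.coeff i) (hm : ¬ (p : ℤ) ∣ f.coeff m)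
    (h0 : m ≠ 0 → ¬ (p : ℤ) ^ 2 ∣ f.coeff 0)
    (hk : m ≠ f.natDegree → ¬ (p : ℤ) ^ 2 ∣ f.coeff f.natDegree) :
    g.natDegree = 0 ∨ h.natDegree = 0 ∨ g.natDegree = m ∨ h.natDegree = m := by
  have : Fact p.Prime := ⟨hp⟩
  have hg0 : g ≠ 0 := by rintro rfl; simp at hf; exact hf0 hf
  have hh0 : h ≠ 0 := by rintro rfl; simp at hf; exact hf0 hf
  have hdeg : f.natDegree = g.natDegree + h.natDegree := by rw [hf, natDegree_mul hg0 hh0]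
  have hu : ((f.coeff m : ℤ) : ZMod p) ≠ 0 := by
    rwa [Ne, ZMod.intCast_zmod_eq_zero_iff_dvd]
  have hmap : f.map (Int.castRingHom (ZMod p)) = C ((f.coeff m : ℤ) : ZMod p) * X ^ m := by
    ext i
    rw [coeff_map, coeff_C_mul, coeff_X_pow]
    by_cases hi : i = m
    · simp [hi]
    · simp [hi, (ZMod.intCast_zmod_eq_zero_iff_dvd _ p).mpr (hd i hi)]
  have hmul : g.map (Int.castRingHom (ZMod p)) * h.map (Int.castRingHom (ZMod p))
      = C ((f.coeff m : ℤ) : ZMod p) * X ^ m := by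
    rw [← hmap, hf, Polynomial.map_mul]
  obtain ⟨s, v, hv, hgs⟩ := mono_of_dvd p g _ hu m (Dvd.intro _ hmul)
  obtain ⟨t, w, hw, hht⟩ := mono_of_dvd p h _ hu m (Dvd.intro_left _ hmul)
  have hst : s + t = m := by
    have := congrArg natDegree hmul
    rw [hgs, hht, natDegree_mul (by simp [hv]) (by simp [hw]), natDegree_C_mul_X_pow _ _ hv,
      natDegree_C_mul_X_pow _ _ hw, natDegree_C_mul_X_pow _ _ hu] at this
    exact this
  obtain ⟨hg1, hg2⟩ := coeff_of_map p g v hv s hgs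
  obtain ⟨hh1, hh2⟩ := coeff_of_map p h w hw t hht
  have hsle : s ≤ g.natDegree := by
    apply le_natDegree_of_ne_zero
    intro hz; exact hg2 (by rw [hz]; exact dvd_zero _)
  have htle : t ≤ h.natDegree := by
    apply le_natDegree_of_ne_zero
    intro hz; exact hh2 (by rw [hz]; exact dvd_zero _)
  have A : s = 0 ∨ t = 0 := by
    by_contra! hcon
    apply h0 (by omega)
    rw [hf, mul_coeff_zero, pow_two]
    exact mul_dvd_mul (hg1 0 (Ne.symm hcon.1)) (hh1 0 (Ne.symm hcon.2))
  have B : s = g.natDegree ∨ t = h.natDegree := by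
    by_contra! hcon
    apply hk (by omega)
    rw [hdeg, hf, coeff_mul_degree_add_degree, pow_two]
    exact mul_dvd_mul (hg1 _ (Ne.symm hcon.1)) (hh1 _ (Ne.symm hcon.2))
  omega

lemma choose_identity (n k j : ℕ) (hj : j ≤ k) (hn : k < n) :
    n.choose j * (n - j - 1).choose (k - j) * ((n - j) * (Nat.factorial j * Nat.factorial (k - j)))
      = ∏ i ∈ Finset.range (k + 1), (n - i) := by
  rw [← Nat.descFactorial_eq_prod_range]
  apply Nat.eq_of_mul_eq_mul_left (Nat.factorial_pos (n - (k + 1)))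
  rw [Nat.factorial_mul_descFactorial (by omega : k + 1 ≤ n)]
  have h1 := Nat.choose_mul_factorial_mul_factorial (by omega : j ≤ n)
  have h2 := Nat.choose_mul_factorial_mul_factorial (by omega : k - j ≤ n - j - 1)
  have e : n - j - 1 - (k - j) = n - (k + 1) := by omega
  rw [e] at h2
  have h3 := Nat.mul_factorial_pred (by omega : n - j ≠ 0)
  rw [← h1, ← h3, ← h2]
  ring

lemma prod_facts (n k p m : ℕ) (hp : p.Prime) (hm : m ≤ k) (hpk : k < p)
    (hn : k < n) (h1 : p ∣ n - m) (h2 : ¬ p ^ 2 ∣ n - m) :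
    p ∣ ∏ i ∈ Finset.range (k + 1), (n - i) ∧ ¬ p ^ 2 ∣ ∏ i ∈ Finset.range (k + 1), (n - i) ∧
    ∀ j ≤ k, j ≠ m → ¬ p ∣ n - j := by
  have hj : ∀ j ≤ k, j ≠ m → ¬ p ∣ n - j := by
    intro j hj hne hd
    rcases lt_or_gt_of_ne hne with h | h
    · have := Nat.dvd_sub hd h1
      have := Nat.le_of_dvd (by omega) this
      omega
    · have := Nat.dvd_sub h1 hd
      have := Nat.le_of_dvd (by omega) this
      omega
  have hmem : m ∈ Finset.range (k + 1) := by simp; omega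
  refine ⟨h1.trans (Finset.dvd_prod_of_mem _ hmem), ?_, hj⟩
  rw [← Finset.mul_prod_erase _ _ hmem]
  intro hd
  apply h2
  refine Nat.Coprime.dvd_of_dvd_mul_right ?_ hd
  apply Nat.Coprime.pow_left
  apply Nat.Coprime.prod_right
  intro i hi
  simp only [Finset.mem_erase, Finset.mem_range] at hi
  exact (Nat.Prime.coprime_iff_not_dvd hp).mpr (hj i (by omega) hi.1)

/-- The `p`-divisibility of the coefficients `c n k j`. -/
lemma c_facts (n k p m : ℕ) (hp : p.Prime) (hm : m ≤ k) (hpk : k < p)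
    (hn : k < n) (h1 : p ∣ n - m) (h2 : ¬ p ^ 2 ∣ n - m) (j : ℕ) (hj : j ≤ k) :
    (j ≠ m → p ∣ (c n k j).natAbs) ∧ ¬ p ^ 2 ∣ (c n k j).natAbs ∧
      ¬ p ∣ (c n k m).natAbs := by
  have habs : ∀ j, (c n k j).natAbs = n.choose j * (n - j - 1).choose (k - j) := by
    intro j
    simp [c, Int.natAbs_mul, Int.natAbs_pow]
  obtain ⟨hD, hD2, hne⟩ := prod_facts n k p m hp hm hpk hn h1 h2
  have hfac : ∀ i ≤ k, ¬ p ∣ Nat.factorial i := by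
    intro i hi h
    have := (Nat.Prime.dvd_factorial hp).mp h
    omega
  rw [habs, habs]
  refine ⟨fun hjm => ?_, fun h => ?_, fun h => ?_⟩
  · rw [← choose_identity n k j hj hn] at hD
    rcases hp.dvd_mul.mp hD with h | h
    · exact h
    · rcases hp.dvd_mul.mp h with h | h
      · exact absurd h (hne j hj hjm)
      · rcases hp.dvd_mul.mp h with h | h
        · exact absurd h (hfac _ hj)
        · exact absurd h (hfac _ (by omega))
  · apply hD2
    rw [← choose_identity n k j hj hn]
    exact h.mul_right _
  · apply hD2
    rw [← choose_identity n k m hm hn, pow_two]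
    exact mul_dvd_mul h (h1.mul_right _)

/-- The integral version of `F`. -/
noncomputable def FZ (n k : ℕ) (a : ℕ → ℤ) : ℤ[X] :=
  ∑ j ∈ Finset.range (k + 1), C (a j * c n k j) * X ^ j

lemma FZ_coeff (n k : ℕ) (a : ℕ → ℤ) (i : ℕ) :
    (FZ n k a).coeff i = if i ≤ k then a i * c n k i else 0 := by
  simp only [FZ, finsetSum_coeff, coeff_C_mul, coeff_X_pow, mul_ite, mul_one, mul_zero,
    Finset.sum_ite_eq, Finset.mem_range, Nat.lt_succ_iff]

lemma FZ_map (n k : ℕ) (a : ℕ → ℤ) : (FZ n k a).map (Int.castRingHom ℚ) = F n k a := by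
  simp [FZ, F, Polynomial.map_sum]

lemma c_ne_zero (n k j : ℕ) (hn : k < n) (hj : j ≤ k) : c n k j ≠ 0 := by
  unfold c
  have h1 := Nat.choose_pos (by omega : j ≤ n)
  have h2 := Nat.choose_pos (by omega : k - j ≤ n - j - 1)
  refine mul_ne_zero (mul_ne_zero (by simp) ?_) ?_
  · exact_mod_cast h1.ne'
  · exact_mod_cast h2.ne'

lemma FZ_natDegree (n k : ℕ) (a : ℕ → ℤ) (hn : k < n) (ha : a k ≠ 0) :
    (FZ n k a).natDegree = k := by
  apply natDegree_eq_of_le_of_coeff_ne_zero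
  · rw [natDegree_le_iff_coeff_eq_zero]
    intro i hi
    rw [FZ_coeff, if_neg (by omega)]
  · rw [FZ_coeff, if_pos le_rfl]
    exact mul_ne_zero ha (c_ne_zero n k k hn le_rfl)

lemma FZ_constraint (n k p : ℕ) (a : ℕ → ℤ)
    (ha : ∀ j ≤ k, a j ≠ 0 ∧ ∀ p : ℕ, p.Prime → (p : ℤ) ∣ a j → p ≤ k)
    (hp : p.Prime) (hpk : k < p) (hn : k < n) (m : ℕ) (hm : m ≤ k)
    (h1 : p ∣ n - m) (h2 : ¬ p ^ 2 ∣ n - m)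
    (g h : ℤ[X]) (hf : FZ n k a = g * h) :
    g.natDegree = 0 ∨ h.natDegree = 0 ∨ g.natDegree = m ∨ h.natDegree = m := by
  have hdeg := FZ_natDegree n k a hn (ha k le_rfl).1
  have hpi : Prime (p : ℤ) := Nat.prime_iff_prime_int.mp hp
  have hna : ∀ j ≤ k, ¬ (p : ℤ) ∣ a j := by
    intro j hj hd
    have := (ha j hj).2 p hp hd
    omega
  have hcf := c_facts n k p m hp hm hpk hn h1 h2
  have sq : ∀ j ≤ k, ¬ (p : ℤ) ^ 2 ∣ (FZ n k a).coeff j := by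
    intro j hj hd
    rw [FZ_coeff, if_pos hj] at hd
    have hcop : IsCoprime ((p : ℤ) ^ 2) (a j) :=
      IsCoprime.pow_left ((Prime.coprime_iff_not_dvd hpi).mpr (hna j hj))
    have := hcop.dvd_of_dvd_mul_left hd
    apply (hcf j hj).2.1
    have h3 : ((p ^ 2 : ℕ) : ℤ) ∣ c n k j := by exact_mod_cast this
    exact Int.natCast_dvd.mp h3
  refine degree_constraint p hp (FZ n k a) g h hf ?_ m ?_ ?_ (fun _ => sq 0 (by omega))
    (fun _ => by rw [hdeg]; exact sq k le_rfl)
  · intro hz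
    apply sq 0 (by omega)
    simp [hz]
  · intro i hi
    rw [FZ_coeff]
    split_ifs with hik
    · exact Dvd.dvd.mul_left (Int.natCast_dvd.mpr ((hcf i hik).1 hi)) _
    · exact dvd_zero _
  · rw [FZ_coeff, if_pos hm]
    intro hd
    rcases hpi.dvd_or_dvd hd with h | h
    · exact hna m hm h
    · exact (hcf m hm).2.2 (Int.natCast_dvd.mp h)

/-- Irreducibility from the absence of nontrivial integral factorizations. -/
lemma irreducible_of_factor (f : ℤ[X]) (hd : 0 < f.natDegree)
    (H : ∀ g h : ℤ[X], f = g * h → g.natDegree = 0 ∨ h.natDegree = 0) :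
    Irreducible (f.map (Int.castRingHom ℚ)) := by
  have hf0 : f ≠ 0 := by rintro rfl; simp at hd
  have hc : f.content ≠ 0 := by rwa [Ne, content_eq_zero_iff]
  have hprim := f.isPrimitive_primPart
  have hirr : Irreducible f.primPart := by
    constructor
    · intro hu
      have := natDegree_eq_zero_of_isUnit hu
      rw [natDegree_primPart] at this
      omega
    · intro g h hgh
      have unit_of : ∀ g h : ℤ[X], f.primPart = g * h → g.natDegree = 0 → IsUnit g := by
        intro g h hgh h0
        rw [natDegree_eq_zero] at h0
        obtain ⟨r, rfl⟩ := h0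
        exact isUnit_C.mpr (hprim r (Dvd.intro _ hgh.symm))
      have hf : f = (C f.content * g) * h := by
        rw [mul_assoc, ← hgh]; exact f.eq_C_content_mul_primPart
      rcases H _ _ hf with h0 | h0
      · rw [natDegree_C_mul hc] at h0
        exact Or.inl (unit_of g h hgh h0)
      · exact Or.inr (unit_of h g (by rw [hgh, mul_comm]) h0)
  have h2 := (IsPrimitive.Int.irreducible_iff_irreducible_map_cast hprim).mp hirr
  have h3 : f.map (Int.castRingHom ℚ)
      = C ((f.content : ℤ) : ℚ) * f.primPart.map (Int.castRingHom ℚ) := by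
    conv_lhs => rw [f.eq_C_content_mul_primPart]
    simp
  rw [h3]
  have hu : IsUnit (C ((f.content : ℤ) : ℚ)) :=
    isUnit_C.mpr (isUnit_iff_ne_zero.mpr (by exact_mod_cast hc))
  exact (irreducible_isUnit_mul hu).mpr h2

/-- Boolean test that `p` is a prime above `k` exactly dividing `n - n % p`, with `n % p ≤ k`. -/
def good (n k p : ℕ) : Bool :=
  decide (k < p) && decide (n % p ≤ k) && decide ((n - n % p) % p ^ 2 ≠ 0) &&
    decide (p < 625) && (List.range 25).all fun m =>
      Nat.ble m 1 || Nat.ble (p + 1) (m * m) || Nat.ble 1 (p % m)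

lemma good_spec (n k p : ℕ) (hk : 4 ≤ k) (h : good n k p = true) :
    k < p ∧ n % p ≤ k ∧ ¬ p ^ 2 ∣ n - n % p ∧ p.Prime := by
  simp only [good, Bool.and_eq_true, decide_eq_true_eq, List.all_eq_true, List.mem_range,
    Bool.or_eq_true, Nat.ble_eq] at h
  obtain ⟨⟨⟨⟨h1, h2⟩, h3⟩, h5⟩, h4⟩ := h
  refine ⟨h1, h2, fun hd => h3 (Nat.mod_eq_zero_of_dvd hd), ?_⟩
  rw [Nat.prime_def_le_sqrt]
  refine ⟨by omega, fun m hm2 hmp hd => ?_⟩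
  have hmm := Nat.le_sqrt.mp hmp
  have hm25 : m < 25 := by
    nlinarith
  rcases h4 m hm25 with h | h
  · omega
  · rw [Nat.mod_eq_zero_of_dvd hd] at h
    omega

/-- The certificate: two (possibly equal) primes forcing irreducibility. -/
def cert (n k p q : ℕ) : Bool :=
  decide (k < n) && good n k p && good n k q &&
    (decide (n % p = 0) || decide (n % p = k) ||
      (decide (n % p ≠ n % q) && decide (n % p + n % q ≠ k)))

lemma irreducible_of_cert (n k p q : ℕ) (hk : 4 ≤ k) (hc : cert n k p q = true) (a : ℕ → ℤ)
    (ha : ∀ j ≤ k, a j ≠ 0 ∧ ∀ p : ℕ, p.Prime → (p : ℤ) ∣ a j → p ≤ k) :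
    Irreducible (F n k a) := by
  simp only [cert, Bool.and_eq_true, Bool.or_eq_true, decide_eq_true_eq] at hc
  obtain ⟨⟨⟨hn, hp⟩, hq⟩, hpq⟩ := hc
  obtain ⟨p1, p2, p3, p4⟩ := good_spec n k p hk hp
  obtain ⟨q1, q2, q3, q4⟩ := good_spec n k q hk hq
  have hdeg := FZ_natDegree n k a hn (ha k le_rfl).1
  rw [← FZ_map]
  apply irreducible_of_factor _ (by omega)
  intro g h hf
  have A := FZ_constraint n k p a ha p4 p1 hn _ p2 (Nat.dvd_sub_mod n) p3 g h hf
  have B := FZ_constraint n k q a ha q4 q1 hn _ q2 (Nat.dvd_sub_mod n) q3 g h hf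
  have hf0 : FZ n k a ≠ 0 := by intro hz; rw [hz] at hdeg; simp at hdeg; omega
  have hsum : g.natDegree + h.natDegree = k := by
    rw [← hdeg, hf, natDegree_mul]
    · rintro rfl; simp at hf; exact hf0 hf
    · rintro rfl; simp at hf; exact hf0 hf
  omega

/-- All pairs `(n, k)`, each with two (possibly equal) certifying primes. The entries for
`k = 3` and for the three excluded pairs carry dummy primes. -/
def certs : List (ℕ × ℕ × ℕ × ℕ) :=
  [(6, 3, 0, 0), (8, 3, 0, 0), (9, 3, 0, 0), (10, 3, 0, 0), (18, 3, 0, 0), (9, 4, 5, 5),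
    (10, 5, 0, 0), (11, 5, 11, 11), (12, 5, 7, 7), (13, 5, 13, 13), (16, 5, 11, 11),
    (18, 5, 13, 13), (19, 5, 7, 7), (20, 5, 17, 19), (27, 5, 11, 11), (28, 5, 7, 7),
    (12, 6, 0, 0), (13, 6, 7, 7), (20, 6, 7, 7), (14, 7, 11, 13), (15, 7, 11, 13),
    (16, 7, 11, 13), (18, 7, 11, 11), (20, 7, 13, 13), (21, 7, 17, 19), (30, 7, 23, 23),
    (16, 8, 0, 0), (21, 8, 13, 13), (26, 13, 17, 19), (27, 13, 17, 19), (28, 13, 17, 19),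
    (30, 13, 17, 17), (32, 13, 19, 19), (33, 13, 23, 29), (36, 13, 23, 23), (28, 14, 17, 19),
    (33, 14, 19, 19), (36, 17, 19, 19)] ++
  [(38, 19, 23, 29), (39, 19, 23, 29), (40, 19, 23, 29), (42, 19, 23, 23), (40, 20, 23, 29),
    (94, 47, 53, 59), (95, 47, 53, 59), (96, 47, 53, 59), (100, 47, 53, 53), (96, 48, 53, 59),
    (144, 71, 73, 73), (145, 71, 79, 83), (145, 72, 73, 73), (146, 73, 79, 83), (147, 73, 79, 83),
    (148, 73, 79, 83), (156, 73, 83, 83), (148, 74, 79, 83), (162, 79, 83, 83), (166, 83, 89, 97),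
    (172, 83, 89, 89), (190, 83, 107, 107), (192, 83, 109, 109), (178, 89, 97, 101),
    (190, 89, 101, 101), (192, 89, 103, 103), (210, 103, 107, 107), (211, 103, 211, 211),
    (212, 103, 109, 109), (213, 103, 113, 127), (216, 103, 113, 113), (217, 103, 107, 127),
    (213, 104, 109, 109), (217, 104, 113, 113), (214, 107, 109, 113), (215, 107, 109, 113),
    (216, 107, 109, 109), (217, 107, 113, 127), (218, 107, 109, 109), (219, 107, 109, 127),
    (220, 107, 113, 113), (221, 107, 109, 127), (222, 107, 109, 127), (223, 107, 223, 223),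
    (224, 107, 109, 127), (225, 107, 109, 127), (216, 108, 109, 113), (217, 108, 109, 109),
    (218, 108, 109, 109), (219, 108, 109, 113), (220, 108, 109, 113), (221, 108, 113, 113),
    (222, 108, 109, 127), (223, 108, 223, 223), (224, 108, 109, 127), (225, 108, 109, 127),
    (218, 109, 113, 127), (219, 109, 113, 127), (220, 109, 113, 127), (221, 109, 113, 127),
    (222, 109, 113, 113), (223, 109, 223, 223), (224, 109, 127, 131), (225, 109, 127, 131),
    (226, 109, 113, 113), (220, 110, 113, 127), (221, 110, 113, 127), (222, 110, 113, 127),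
    (223, 110, 113, 113), (224, 110, 127, 131), (225, 110, 127, 131), (226, 110, 113, 113),
    (222, 111, 113, 127), (223, 111, 223, 223), (224, 111, 113, 113), (225, 111, 127, 131),
    (226, 111, 113, 113), (224, 112, 113, 127), (225, 112, 113, 113), (226, 112, 113, 113),
    (226, 113, 127, 131), (227, 113, 227, 227), (228, 113, 127, 131), (229, 113, 229, 229),
    (230, 113, 127, 131), (231, 113, 127, 131), (232, 113, 127, 131), (250, 113, 137, 137),
    (252, 113, 139, 139), (253, 113, 149, 151), (228, 114, 127, 131), (229, 114, 229, 229),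
    (230, 114, 127, 131), (231, 114, 127, 131), (232, 114, 127, 131), (253, 114, 139, 139),
    (230, 115, 127, 131), (231, 115, 127, 131), (232, 115, 127, 131), (232, 116, 127, 131),
    (346, 173, 179, 181), (378, 181, 197, 197), (380, 181, 199, 199), (381, 181, 211, 223),
    (381, 182, 199, 199), (392, 193, 199, 199), (393, 193, 211, 223), (393, 194, 199, 199),
    (396, 197, 199, 199), (398, 199, 211, 223), (399, 199, 211, 223), (400, 199, 211, 223),
    (400, 200, 211, 223), (552, 271, 281, 281), (553, 271, 283, 293), (554, 271, 277, 277),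
    (555, 271, 277, 293), (556, 271, 277, 293), (553, 272, 281, 281), (555, 272, 283, 283),
    (556, 272, 277, 293), (556, 273, 283, 283), (554, 277, 281, 283), (555, 277, 281, 283),
    (556, 277, 281, 283), (558, 277, 281, 281), (559, 277, 283, 293), (560, 277, 283, 283),
    (561, 277, 293, 307), (562, 277, 281, 281), (556, 278, 281, 283), (559, 278, 281, 281),
    (560, 278, 283, 293), (561, 278, 283, 283), (562, 278, 281, 281), (560, 279, 281, 281),
    (561, 279, 283, 293), (562, 279, 281, 281), (561, 280, 281, 281), (562, 281, 283, 293),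
    (563, 281, 563, 563), (564, 281, 283, 283), (565, 281, 293, 307), (566, 281, 283, 283),
    (567, 281, 283, 293), (568, 281, 283, 293), (564, 282, 283, 293), (565, 282, 283, 283),
    (566, 282, 283, 283), (567, 282, 283, 293), (568, 282, 283, 293), (566, 283, 293, 307),
    (567, 283, 293, 307), (568, 283, 293, 307), (569, 283, 569, 569), (570, 283, 293, 307),
    (576, 283, 293, 293), (568, 284, 293, 307), (569, 284, 569, 569), (570, 284, 293, 307),
    (570, 285, 293, 307), (586, 293, 307, 311)]

/-- The underlying list of pairs. -/
def pairs : List (ℕ × ℕ) := certs.map fun x => (x.1, x.2.1)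

lemma all_ok : (certs.all fun x => decide (x.2.1 < 4) ||
    decide ((x.1, x.2.1) = (10, 5) ∨ (x.1, x.2.1) = (12, 6) ∨ (x.1, x.2.1) = (16, 8)) ||
    cert x.1 x.2.1 x.2.2.1 x.2.2.2) = true := by
  decide +kernel

set_option maxRecDepth 20000 in
lemma mem_pairs (n k : ℕ) (hST : (n, k) ∈ S ∪ T) : (n, k) ∈ pairs := by
  rcases hST with h | h
  · unfold S at h
    simp only [Set.mem_insert_iff, Set.mem_singleton_iff] at h
    unfold pairs certs
    simp only [List.map_append, List.map_cons, List.map_nil, List.mem_append,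
      List.mem_cons, List.not_mem_nil, or_false]
    exact Or.inl h
  · unfold T at h
    simp only [Set.mem_insert_iff, Set.mem_singleton_iff] at h
    unfold pairs certs
    simp only [List.map_append, List.map_cons, List.map_nil, List.mem_append,
      List.mem_cons, List.not_mem_nil, or_false]
    exact Or.inr h

theorem F_irreducible_on_S_union_T (n k : ℕ) (hST : (n, k) ∈ S ∪ T) (hk : 4 ≤ k)
    (hS' : (n, k) ∉ ({(10, 5), (12, 6), (16, 8)} : Set (ℕ × ℕ)))
    (a : ℕ → ℤ) (ha : ∀ j ≤ k, a j ≠ 0 ∧ ∀ p : ℕ, p.Prime → (p : ℤ) ∣ a j → p ≤ k) :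
    Irreducible (F n k a) := by
  have hmem : (n, k) ∈ pairs := mem_pairs n k hST
  obtain ⟨⟨n1, k1, p, q⟩, hx, hxe⟩ := List.mem_map.mp hmem
  obtain ⟨rfl, rfl⟩ := Prod.mk.inj hxe
  have hok := List.all_eq_true.mp all_ok _ hx
  simp only [Bool.or_eq_true, decide_eq_true_eq] at hok
  simp only [Set.mem_insert_iff, Set.mem_singleton_iff] at hS'
  rcases hok with (h | h) | h
  · dsimp only at hk
    omega
  · exact absurd h hS'
  · exact irreducible_of_cert _ _ p q hk h a ha
end
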